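/- Let a, b, c be reals with a > 0 and b > 0, let L be the 2×2 symmetric matrix with rows (a, c) and (c, b), and let D = Diag(L) = diag(a, b). Then the matrix W = ½(L D + D L) has entries W₁₁ = a², W₂₂ = b², W₁₂ = W₂₁ = c(a+b)/2, and if c > 2ab/(a+b), then det(W) < 0, so W is not positive semidefinite. -/

import Mathlib

open Matrix

/-- For `L = !![a, c; c, b]` with `a, b > 0`, `D = Diag(L)` and
`W = ½ (L D + D L)`, the entries of `W` are `a²`, `b²` and `c(a+b)/2`, and if
`c > 2ab/(a+b)` then `det W < 0` and `W` is not positive semidefinite. -/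
theorem stmt_2 (a b c : ℝ) (ha : 0 < a) (hb : 0 < b)
    (L D W : Matrix (Fin 2) (Fin 2) ℝ)
    (hL : L = !![a, c; c, b])
    (hD : D = Matrix.diagonal (fun i => L i i))
    (hW : W = (1 / 2 : ℝ) • (L * D + D * L)) :
    W 0 0 = a ^ 2 ∧ W 1 1 = b ^ 2 ∧
      W 0 1 = c * (a + b) / 2 ∧ W 1 0 = c * (a + b) / 2 ∧
      (c > 2 * a * b / (a + b) → W.det < 0 ∧ ¬ W.PosSemidef) := by
  have entry (i j : Fin 2) : W i j = 1 / 2 * (L i j * L j j + L i i * L i j) := by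
    rw [hW, hD, Matrix.smul_apply, Matrix.add_apply, Matrix.mul_diagonal,
      Matrix.diagonal_mul, smul_eq_mul]
  have h00 : W 0 0 = a ^ 2 := by
    simp [entry, hL]; ring
  have h11 : W 1 1 = b ^ 2 := by
    simp [entry, hL]; ring
  have h01 : W 0 1 = c * (a + b) / 2 := by
    simp [entry, hL]; ring
  have h10 : W 1 0 = c * (a + b) / 2 := by
    simp [entry, hL]; ring
  refine ⟨h00, h11, h01, h10, fun hc => ?_⟩
  have hdet : W.det < 0 := by
    rw [Matrix.det_fin_two, h00, h11, h01, h10]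
    have hlt : 2 * a * b < c * (a + b) := (div_lt_iff₀ (by positivity)).mp hc
    nlinarith [mul_pos ha hb]
  exact ⟨hdet, fun h => hdet.not_ge h.det_nonneg⟩
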